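/- arXiv:1904.05409 — 4 statements merged into one kernel-verified Lean document; each statement's English description precedes it below -/
import Mathlib

section
/- Let k be a field of characteristic 0 and let β₂(k) be the k-vector space generated by symbols ⟨a⟩ for a ∈ k^♭, modulo the k-subspace spanned by the four-term elements ⟨p⟩ - ⟨q⟩ + p·⟨q/p⟩ + (1-p)·⟨(1-q)/(1-p)⟩ for all p, q ∈ k^♭ with p ≠ q. Then for every p ∈ k^♭, the classes of ⟨p⟩ and ⟨1-p⟩ in β₂(k) are equal. -/
open Finsupp

/-- `k^♭`: the set of elements `a` with both `a` and `1 - a` units, as a subtype. -/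
abbrev kflat (k : Type*) [Field k] : Type _ := {a : k // IsUnit a ∧ IsUnit (1 - a)}

/-- The four-term relations of Cathelineau inside the free `k`-vector space on `k^♭`:
`⟨p⟩ - ⟨q⟩ + p·⟨q/p⟩ + (1-p)·⟨(1-q)/(1-p)⟩` for `p ≠ q` in `k^♭`. -/
def fourTermSet (k : Type*) [Field k] : Set (kflat k →₀ k) :=
  {v | ∃ p q r s : kflat k, (p : k) ≠ (q : k) ∧ (r : k) = (q : k) / (p : k) ∧
    (s : k) = (1 - (q : k)) / (1 - (p : k)) ∧
    v = single p 1 - single q 1 + (p : k) • single r 1 + (1 - (p : k)) • single s 1}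

/-- `β₂(k)`: the free `k`-vector space on `k^♭` modulo the four-term relations. -/
abbrev beta2 (k : Type*) [Field k] : Type _ :=
  (kflat k →₀ k) ⧸ Submodule.span k (fourTermSet k)

/-- The class of the generator `⟨a⟩` in `β₂(k)`. -/
noncomputable def beta2Mk {k : Type*} [Field k] (a : kflat k) : beta2 k :=
  Submodule.Quotient.mk (single a 1)

theorem beta2Mk_four_term {k : Type*} [Field k] (p q r s : kflat k) (hpq : (p : k) ≠ q)
    (hr : (r : k) = (q : k) / p) (hs : (s : k) = (1 - (q : k)) / (1 - (p : k))) :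
    beta2Mk p - beta2Mk q + (p : k) • beta2Mk r + (1 - (p : k)) • beta2Mk s = 0 :=
  (Submodule.Quotient.mk_eq_zero _).mpr
    (Submodule.subset_span ⟨p, q, r, s, hpq, hr, hs, rfl⟩)

theorem div_mem_kflat {k : Type*} [Field k] (p q : kflat k) (hpq : (p : k) ≠ q) :
    IsUnit ((q : k) / p) ∧ IsUnit (1 - (q : k) / p) := by
  have hp := p.2.1.ne_zero
  refine ⟨q.2.1.div p.2.1, isUnit_iff_ne_zero.mpr (sub_ne_zero.mpr fun h => hpq ?_)⟩
  exact (div_eq_one_iff_eq hp).mp h.symm |>.symm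

theorem beta2_symbol_eq_symbol_one_sub (k : Type*) [Field k] [CharZero k] :
    ∀ p q : kflat k, (q : k) = 1 - (p : k) → beta2Mk p = beta2Mk q := by
  intro p q hq
  by_cases hpq : (p : k) = q
  · rw [Subtype.ext hpq]
  have hp : 1 - (q : k) = p := by rw [hq]; ring
  let r : kflat k := ⟨(q : k) / p, div_mem_kflat p q hpq⟩
  let s : kflat k := ⟨(p : k) / q, div_mem_kflat q p (Ne.symm hpq)⟩
  have h₁ := beta2Mk_four_term p q r s hpq rfl (by rw [hp, ← hq])
  have h₂ := beta2Mk_four_term q p s r (Ne.symm hpq) rfl (by rw [hp, ← hq])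
  rw [← hq] at h₁
  rw [hp] at h₂
  have h₃ : (2 : k) • (beta2Mk p - beta2Mk q) = 0 := by
    linear_combination (norm := module) h₁ - h₂
  exact sub_eq_zero.mp ((smul_eq_zero.mp h₃).resolve_left two_ne_zero)
end

section
/- Let k be a field of characteristic 0. For a ∈ k^♭ define D⟨a⟩ := a ⊗ a + (1-a) ⊗ (1-a) in the abelian group k ⊗_ℤ k^× (where the units group k^× is written additively in the second tensor factor, and k acts on the first factor). Then for all p, q ∈ k^♭ with p ≠ q, one has D⟨p⟩ - D⟨q⟩ + p·D⟨q/p⟩ + (1-p)·D⟨(1-q)/(1-p)⟩ = 0 in k ⊗_ℤ k^×, where λ·(a ⊗ b) := (λa) ⊗ b. In other words, the map D annihilates the four-term relation of Cathelineau. -/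
open TensorProduct
open scoped Classical

/-- The unit of a field attached to a nonzero element (junk value `1` at `0`). -/
noncomputable def unitOf {k : Type*} [Field k] (a : k) : kˣ :=
  if h : a = 0 then 1 else Units.mk0 a h

/-- Cathelineau's map `D⟨a⟩ = a ⊗ a + (1-a) ⊗ (1-a)` in `k ⊗_ℤ k^×`
(the units group written additively). -/
noncomputable def cathelineauD {k : Type*} [Field k] (a : k) :
    TensorProduct ℤ k (Additive kˣ) :=
  a ⊗ₜ Additive.ofMul (unitOf a) + (1 - a) ⊗ₜ Additive.ofMul (unitOf (1 - a))

theorem unitOf_of_ne_zero {k : Type*} [Field k] {a : k} (ha : a ≠ 0) :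
    unitOf a = Units.mk0 a ha :=
  dif_neg ha

theorem unitOf_div {k : Type*} [Field k] {a b : k} (ha : a ≠ 0) (hb : b ≠ 0) :
    unitOf (a / b) = unitOf a / unitOf b := by
  rw [unitOf_of_ne_zero ha, unitOf_of_ne_zero hb, unitOf_of_ne_zero (div_ne_zero ha hb)]
  ext
  simp

theorem unitOf_neg {k : Type*} [Field k] {a : k} (ha : a ≠ 0) :
    unitOf (-a) = -1 * unitOf a := by
  rw [unitOf_of_ne_zero ha, unitOf_of_ne_zero (neg_ne_zero.mpr ha)]
  ext
  simp

/-- Multiplication by `2` is invertible on `k`, so the torsion unit `-1` dies in `k ⊗ kˣ`. -/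
theorem tmul_ofMul_neg_one {k : Type*} [Field k] [CharZero k] (x : k) :
    x ⊗ₜ[ℤ] Additive.ofMul (-1 : kˣ) = 0 := by
  have hx : x = (2 : ℤ) • (x / 2) := by
    rw [zsmul_eq_mul]
    push_cast
    field_simp
  have h : (2 : ℤ) • Additive.ofMul (-1 : kˣ) = 0 := by
    rw [← ofMul_zpow]
    norm_num
  rw [hx, TensorProduct.smul_tmul, h, TensorProduct.tmul_zero]

theorem tmul_ofMul_unitOf_neg {k : Type*} [Field k] [CharZero k] (x : k) {a : k} (ha : a ≠ 0) :
    x ⊗ₜ[ℤ] Additive.ofMul (unitOf (-a)) = x ⊗ₜ[ℤ] Additive.ofMul (unitOf a) := by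
  rw [unitOf_neg ha, ofMul_mul, TensorProduct.tmul_add, tmul_ofMul_neg_one, zero_add]

/-- The rescaled value `b · D⟨a / b⟩`, expanded over the common denominator `b`. -/
theorem smul_cathelineauD_div {k : Type*} [Field k] {a b : k} (ha : a ≠ 0) (hb : b ≠ 0)
    (hab : b - a ≠ 0) :
    b • cathelineauD (a / b) =
      a ⊗ₜ[ℤ] Additive.ofMul (unitOf a) + (b - a) ⊗ₜ[ℤ] Additive.ofMul (unitOf (b - a))
        - b ⊗ₜ[ℤ] Additive.ofMul (unitOf b) := by
  have h : 1 - a / b = (b - a) / b := by field_simp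
  rw [cathelineauD, h, unitOf_div ha hb, unitOf_div hab hb, smul_add, TensorProduct.smul_tmul',
    TensorProduct.smul_tmul', smul_eq_mul, smul_eq_mul, mul_div_cancel₀ _ hb,
    mul_div_cancel₀ _ hb, ofMul_div, ofMul_div, TensorProduct.tmul_sub, TensorProduct.tmul_sub,
    TensorProduct.sub_tmul b a (Additive.ofMul (unitOf b))]
  abel

theorem cathelineauD_four_term (k : Type*) [Field k] [CharZero k] :
    ∀ p q : k, IsUnit p → IsUnit (1 - p) → IsUnit q → IsUnit (1 - q) → p ≠ q →
      cathelineauD p - cathelineauD q + p • cathelineauD (q / p)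
        + (1 - p) • cathelineauD ((1 - q) / (1 - p)) = 0 := by
  intro p q hp hp' hq hq' hpq
  have h : p - q ≠ 0 := sub_ne_zero.mpr hpq
  have e : 1 - p - (1 - q) = -(p - q) := by ring
  rw [smul_cathelineauD_div hq.ne_zero hp.ne_zero h,
    smul_cathelineauD_div hq'.ne_zero hp'.ne_zero (e ▸ neg_ne_zero.mpr h), e,
    tmul_ofMul_unitOf_neg _ h, TensorProduct.neg_tmul, cathelineauD, cathelineauD]
  abel
end

section
/- Let k be a field of characteristic 0 and let β₂(k) be the k-vector space generated by symbols ⟨a⟩ for a ∈ k^♭, modulo the k-subspace spanned by ⟨p⟩ - ⟨q⟩ + p·⟨q/p⟩ + (1-p)·⟨(1-q)/(1-p)⟩ for all p, q ∈ k^♭ with p ≠ q. Let D: β₂(k) → k ⊗_ℤ k^× be the k-linear map induced by D⟨a⟩ = a ⊗ a + (1-a) ⊗ (1-a), and let L: k ⊗_ℤ k^× → Ω¹_{k/ℚ} be the map sending a ⊗ b to a·(db)/b, where Ω¹_{k/ℚ} is the module of Kähler differentials of k over ℚ. Then the sequence 0 → β₂(k) → k ⊗_ℤ k^× → Ω¹_{k/ℚ}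 → 0 is exact: D is injective, L is surjective, and the image of D equals the kernel of L. -/
open Finsupp TensorProduct

open Classical in
/-- The symbol `⟨x⟩` in `β₂(k)`, extended by `0` to all of `k`. -/
noncomputable def beta2Symbol {k : Type*} [Field k] (x : k) : beta2 k :=
  if h : IsUnit x ∧ IsUnit (1 - x) then beta2Mk ⟨x, h⟩ else 0

section Symbol

variable {k : Type*} [Field k]

@[simp] lemma beta2Symbol_zero : beta2Symbol (0 : k) = 0 := by simp [beta2Symbol]

@[simp] lemma beta2Symbol_one : beta2Symbol (1 : k) = 0 := by simp [beta2Symbol]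

lemma beta2Symbol_coe (a : kflat k) : beta2Symbol (a : k) = beta2Mk a := by
  simp only [beta2Symbol, dif_pos a.2]

lemma beta2Symbol_four_term {p q : k} (hp : p ≠ 0) (hp' : 1 - p ≠ 0) (hq : q ≠ 0)
    (hq' : 1 - q ≠ 0) (hpq : p ≠ q) :
    beta2Symbol p - beta2Symbol q + p • beta2Symbol (q / p)
      + (1 - p) • beta2Symbol ((1 - q) / (1 - p)) = 0 := by
  have hr : IsUnit (q / p) ∧ IsUnit (1 - q / p) := by
    refine ⟨(div_ne_zero hq hp).isUnit, IsUnit.mk0 _ ?_⟩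
    rw [one_sub_div hp]
    exact div_ne_zero (sub_ne_zero.2 hpq) hp
  have hs : IsUnit ((1 - q) / (1 - p)) ∧ IsUnit (1 - (1 - q) / (1 - p)) := by
    refine ⟨(div_ne_zero hq' hp').isUnit, IsUnit.mk0 _ ?_⟩
    rw [one_sub_div hp']
    refine div_ne_zero ?_ hp'
    rw [sub_sub_sub_cancel_left]
    exact sub_ne_zero.2 hpq.symm
  let P : kflat k := ⟨p, hp.isUnit, hp'.isUnit⟩
  let Q : kflat k := ⟨q, hq.isUnit, hq'.isUnit⟩
  let R : kflat k := ⟨q / p, hr⟩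
  let S : kflat k := ⟨(1 - q) / (1 - p), hs⟩
  change beta2Symbol (P : k) - beta2Symbol (Q : k) + p • beta2Symbol (R : k)
    + (1 - p) • beta2Symbol (S : k) = 0
  simp only [beta2Symbol_coe, beta2Mk]
  rw [← Submodule.Quotient.mk_smul, ← Submodule.Quotient.mk_smul, ← Submodule.Quotient.mk_sub,
    ← Submodule.Quotient.mk_add, ← Submodule.Quotient.mk_add, Submodule.Quotient.mk_eq_zero]
  exact Submodule.subset_span ⟨P, Q, R, S, hpq, rfl, rfl, rfl⟩

variable [CharZero k]

lemma beta2Symbol_one_sub (x : k) : beta2Symbol (1 - x) = beta2Symbol x := by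
  by_cases h0 : x = 0
  · simp [h0]
  by_cases h1 : x = 1
  · simp [h1]
  by_cases h2 : x = 1 / 2
  · rw [h2]; norm_num
  have h1' : 1 - x ≠ 0 := sub_ne_zero.2 (Ne.symm h1)
  have e : (1 : k) - 1 / 2 = 1 / 2 := by norm_num
  have hh : (1 / 2 : k) ≠ 0 := by norm_num
  have A := beta2Symbol_four_term (p := x) (q := 1 / 2) h0 h1' hh (e.symm ▸ hh) h2
  have B := beta2Symbol_four_term (p := 1 - x) (q := 1 / 2) h1' (by simpa using h0) hh (e.symm ▸ hh)
    (fun h => h2 (by linear_combination -h))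
  rw [sub_sub_cancel, e] at B
  rw [e] at A
  rw [← sub_eq_zero, ← sub_eq_zero.2 (B.trans A.symm)]
  abel

lemma beta2Symbol_add_smul_inv (x : k) : beta2Symbol x + x • beta2Symbol (x⁻¹) = 0 := by
  by_cases h0 : x = 0
  · simp [h0]
  by_cases h1 : x = 1
  · simp [h1]
  by_cases h2 : x = -1
  · simp [h2, inv_neg]
  have hx2 : x + 1 ≠ 0 := fun h => h2 (eq_neg_of_add_eq_zero_left h)
  have hp : (x + 1)⁻¹ ≠ 0 := inv_ne_zero hx2
  have e1 : 1 - (x + 1)⁻¹ = x / (x + 1) := by field_simp; ring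
  have e2 : 1 - x / (x + 1) = (x + 1)⁻¹ := by field_simp; ring
  have hq : x / (x + 1) ≠ 0 := div_ne_zero h0 hx2
  have hpq : (x + 1)⁻¹ ≠ x / (x + 1) := by
    intro h
    field_simp at h
    exact h1 h.symm
  have A := beta2Symbol_four_term hp (e1 ▸ hq) hq (e2 ▸ hp) hpq
  have B := beta2Symbol_four_term hq (e2 ▸ hp) hp (e1 ▸ hq) hpq.symm
  rw [e1, e2] at A B
  have d1 : x / (x + 1) / (x + 1)⁻¹ = x := by field_simp
  have d2 : (x + 1)⁻¹ / (x / (x + 1)) = x⁻¹ := by field_simp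
  rw [d1, d2] at A B
  have C : (2 * (x + 1)⁻¹) • (beta2Symbol x + x • beta2Symbol (x⁻¹)) = 0 := by
    simp only [div_eq_mul_inv] at A B
    linear_combination (norm := module) A + B
  exact (smul_eq_zero.1 C).resolve_left (mul_ne_zero two_ne_zero hp)

/-- The symmetric `2`-cocycle `(a, b) ↦ (a + b)·⟨a / (a + b)⟩` on the additive group of `k`. -/
noncomputable def beta2Cocycle (a b : k) : beta2 k := (a + b) • beta2Symbol (a / (a + b))

omit [CharZero k] in
@[simp] lemma beta2Cocycle_zero_left (a : k) : beta2Cocycle 0 a = 0 := by simp [beta2Cocycle]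

omit [CharZero k] in
lemma beta2Cocycle_of_add_eq_zero {a b : k} (h : a + b = 0) : beta2Cocycle a b = 0 := by
  simp [beta2Cocycle, h]

omit [CharZero k] in
lemma beta2Cocycle_mul (c a b : k) : beta2Cocycle (c * a) (c * b) = c • beta2Cocycle a b := by
  by_cases hc : c = 0
  · simp [hc]
  · rw [beta2Cocycle, beta2Cocycle, ← mul_add, mul_div_mul_left _ _ hc, mul_smul]

lemma beta2Cocycle_comm (a b : k) : beta2Cocycle a b = beta2Cocycle b a := by
  by_cases h : a + b = 0
  · rw [beta2Cocycle_of_add_eq_zero h, beta2Cocycle_of_add_eq_zero (add_comm a b ▸ h)]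
  · rw [beta2Cocycle, beta2Cocycle, add_comm b a, ← beta2Symbol_one_sub, one_sub_div h,
      add_sub_cancel_left]

@[simp] lemma beta2Cocycle_zero_right (a : k) : beta2Cocycle a 0 = 0 := by
  rw [beta2Cocycle_comm, beta2Cocycle_zero_left]

lemma beta2Cocycle_add_neg (a b : k) : beta2Cocycle (a + b) (-b) = -beta2Cocycle a b := by
  by_cases h : a + b = 0
  · rw [beta2Cocycle_of_add_eq_zero h, h, beta2Cocycle_zero_left, neg_zero]
  · have := beta2Symbol_add_smul_inv (a / (a + b))
    rw [inv_div] at this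
    rw [beta2Cocycle, beta2Cocycle, add_neg_cancel_right, eq_neg_of_add_eq_zero_left this,
      smul_neg, neg_neg, smul_smul, mul_div_cancel₀ _ h]

lemma beta2Cocycle_assoc (a b c : k) :
    beta2Cocycle a b + beta2Cocycle (a + b) c = beta2Cocycle b c + beta2Cocycle a (b + c) := by
  by_cases ha : a = 0
  · simp [ha]
  by_cases hb : b = 0
  · simp [hb]
  by_cases hc : c = 0
  · simp [hc]
  by_cases hab : a + b = 0
  · obtain rfl := eq_neg_of_add_eq_zero_left hab
    rw [hab, beta2Cocycle_zero_left, beta2Cocycle_of_add_eq_zero hab, beta2Cocycle_comm (-b),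
      add_comm b c, beta2Cocycle_add_neg, beta2Cocycle_comm b c, add_zero, add_neg_cancel]
  by_cases hbc : b + c = 0
  · obtain rfl := eq_neg_of_add_eq_zero_right hbc
    rw [beta2Cocycle_add_neg, beta2Cocycle_of_add_eq_zero hbc, hbc, beta2Cocycle_zero_right,
      add_neg_cancel, add_zero]
  by_cases hS : a + b + c = 0
  · obtain rfl := eq_neg_of_add_eq_zero_right hS
    have A := beta2Cocycle_add_neg (-(a + b)) b
    have B := beta2Cocycle_mul (-1) a b
    rw [show -(a + b) + b = -a by ring, beta2Cocycle_comm _ b] at A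
    rw [neg_one_mul, neg_one_mul, neg_one_smul, A, neg_inj] at B
    rw [beta2Cocycle_of_add_eq_zero hS, B,
      beta2Cocycle_of_add_eq_zero (a := a) (b := b + -(a + b)) (by ring), add_zero]
  have hp : 1 - (a + b) / (a + b + c) = c / (a + b + c) := by field_simp; ring
  have hq : 1 - a / (a + b + c) = (b + c) / (a + b + c) := by field_simp; ring
  have A := beta2Symbol_four_term (p := (a + b) / (a + b + c)) (q := a / (a + b + c))
    (div_ne_zero hab hS) (hp ▸ div_ne_zero hc hS) (div_ne_zero ha hS) (hq ▸ div_ne_zero hbc hS)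
    (fun h => hb (by field_simp at h; linear_combination h))
  have B := beta2Cocycle_add_neg c b
  rw [hp, hq, div_div_div_cancel_right₀ hS, div_div_div_cancel_right₀ hS] at A
  rw [← neg_neg (beta2Cocycle b c), beta2Cocycle_comm b c, ← B]
  simp only [beta2Cocycle, add_neg_cancel_right, ← add_assoc]
  have A' := congrArg (fun v => (a + b + c) • v) A
  simp only [smul_add, smul_sub, smul_smul, mul_div_cancel₀ _ hS, smul_zero] at A'
  rw [add_comm c b]
  linear_combination (norm := module) A'

end Symbol

/-- The commutative ring structure on `k × β₂(k)` whose addition is twisted by `beta2Cocycle` and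
whose multiplication is that of the trivial square-zero extension. -/
@[ext]
structure Beta2Extension (k : Type*) [Field k] where
  /-- The component in `k`. -/
  fst : k
  /-- The component in `β₂(k)`. -/
  snd : beta2 k

namespace Beta2Extension

variable {k : Type*} [Field k]

noncomputable instance : Zero (Beta2Extension k) := ⟨⟨0, 0⟩⟩
noncomputable instance : One (Beta2Extension k) := ⟨⟨1, 0⟩⟩
noncomputable instance : Add (Beta2Extension k) :=
  ⟨fun x y => ⟨x.fst + y.fst, x.snd + y.snd + beta2Cocycle x.fst y.fst⟩⟩
noncomputable instance : Neg (Beta2Extension k) := ⟨fun x => ⟨-x.fst, -x.snd⟩⟩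
noncomputable instance : Mul (Beta2Extension k) :=
  ⟨fun x y => ⟨x.fst * y.fst, x.fst • y.snd + y.fst • x.snd⟩⟩

@[simp] lemma fst_zero : (0 : Beta2Extension k).fst = 0 := rfl
@[simp] lemma snd_zero : (0 : Beta2Extension k).snd = 0 := rfl
@[simp] lemma fst_one : (1 : Beta2Extension k).fst = 1 := rfl
@[simp] lemma snd_one : (1 : Beta2Extension k).snd = 0 := rfl
@[simp] lemma fst_add (x y : Beta2Extension k) : (x + y).fst = x.fst + y.fst := rfl
@[simp] lemma snd_add (x y : Beta2Extension k) :
    (x + y).snd = x.snd + y.snd + beta2Cocycle x.fst y.fst := rfl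
@[simp] lemma fst_neg (x : Beta2Extension k) : (-x).fst = -x.fst := rfl
@[simp] lemma snd_neg (x : Beta2Extension k) : (-x).snd = -x.snd := rfl
@[simp] lemma fst_mul (x y : Beta2Extension k) : (x * y).fst = x.fst * y.fst := rfl
@[simp] lemma snd_mul (x y : Beta2Extension k) :
    (x * y).snd = x.fst • y.snd + y.fst • x.snd := rfl

protected lemma add_comm [CharZero k] (x y : Beta2Extension k) : x + y = y + x := by
  ext
  · simp [add_comm]
  · simp [add_comm x.snd, beta2Cocycle_comm x.fst]

protected lemma mul_comm (x y : Beta2Extension k) : x * y = y * x := by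
  ext
  · simp [mul_comm]
  · simp [add_comm]

protected lemma mul_add (x y z : Beta2Extension k) : x * (y + z) = x * y + x * z := by
  ext
  · simp [mul_add]
  · simp only [snd_mul, snd_add, fst_add, fst_mul, beta2Cocycle_mul]
    module

protected lemma one_mul (x : Beta2Extension k) : 1 * x = x := by
  ext <;> simp

variable [CharZero k]

noncomputable instance : CommRing (Beta2Extension k) where
  add_assoc x y z := by
    ext
    · simp [add_assoc]
    · simp only [snd_add, fst_add]
      linear_combination (norm := module) beta2Cocycle_assoc x.fst y.fst z.fst
  zero_add x := by ext <;> simp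
  add_zero x := by ext <;> simp
  add_comm := Beta2Extension.add_comm
  neg_add_cancel x := by
    ext
    · simp
    · simp [beta2Cocycle_of_add_eq_zero]
  mul_assoc x y z := by
    ext
    · simp [mul_assoc]
    · simp only [snd_mul, fst_mul]
      module
  mul_comm := Beta2Extension.mul_comm
  one_mul := Beta2Extension.one_mul
  mul_one x := by rw [Beta2Extension.mul_comm, Beta2Extension.one_mul]
  left_distrib := Beta2Extension.mul_add
  right_distrib x y z := by
    rw [Beta2Extension.mul_comm, Beta2Extension.mul_add, Beta2Extension.mul_comm z,
      Beta2Extension.mul_comm z]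
  zero_mul x := by ext <;> simp
  mul_zero x := by ext <;> simp
  nsmul := nsmulRec
  zsmul := zsmulRec

/-- The projection of the extension onto `k`. -/
noncomputable def fstHom (k : Type*) [Field k] [CharZero k] : Beta2Extension k →+* k where
  toFun := fst
  map_one' := rfl
  map_mul' _ _ := rfl
  map_zero' := rfl
  map_add' _ _ := rfl

lemma ker_fstHom_sq : RingHom.ker (fstHom k) ^ 2 = ⊥ := by
  rw [pow_two, eq_bot_iff, Ideal.mul_le]
  intro x hx y hy
  have hx' : x.fst = 0 := hx
  have hy' : y.fst = 0 := hy
  rw [Ideal.mem_bot]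
  ext <;> simp [hx', hy']

end Beta2Extension

section Splitting

variable (k : Type*) [Field k] [CharZero k]

lemma formallySmooth_rat_of_charZero : Algebra.FormallySmooth ℚ k := by
  obtain ⟨s, hs⟩ := exists_isTranscendenceBasis ℚ k
  have : Algebra.IsAlgebraic (IntermediateField.adjoin ℚ (Set.range ((↑) : s → k))) k :=
    hs.isAlgebraic_field
  exact .of_algebraicIndependent_of_isSeparable hs.1

lemma formallySmooth_int_of_charZero : Algebra.FormallySmooth ℤ k := by
  have := formallySmooth_rat_of_charZero k
  have : Algebra.FormallySmooth ℤ ℚ := .of_isLocalization (nonZeroDivisors ℤ)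
  exact .comp ℤ ℚ k

/-- The cocycle `beta2Cocycle` is the coboundary of a function satisfying the Leibniz rule. -/
lemma exists_leibniz_cobounding_beta2Cocycle : ∃ g : k → beta2 k,
    (∀ a b, g (a + b) = g a + g b + beta2Cocycle a b) ∧
      ∀ a b, g (a * b) = a • g b + b • g a := by
  have := formallySmooth_int_of_charZero k
  let π : Beta2Extension k →ₐ[ℤ] k := (Beta2Extension.fstHom k).toIntAlgHom
  have hπ : Function.Surjective π := fun a => ⟨⟨a, 0⟩, rfl⟩
  let σ : k →ₐ[ℤ] Beta2Extension k := Algebra.FormallySmooth.liftOfSurjective (AlgHom.id ℤ k) π hπ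
    ⟨2, Beta2Extension.ker_fstHom_sq⟩
  have hσ (a : k) : (σ a).fst = a :=
    Algebra.FormallySmooth.liftOfSurjective_apply (AlgHom.id ℤ k) π hπ _ a
  refine ⟨fun a => (σ a).snd, fun a b => ?_, fun a b => ?_⟩
  · simp only [map_add, Beta2Extension.snd_add, hσ]
  · simp only [map_mul, Beta2Extension.snd_mul, hσ]

end Splitting

lemma beta2_hom_ext {k M : Type*} [Field k] [AddCommGroup M] [Module k M] {f g : beta2 k →ₗ[k] M}
    (h : ∀ a, f (beta2Mk a) = g (beta2Mk a)) : f = g := by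
  refine Submodule.linearMap_qext _ (Finsupp.lhom_ext' fun a => LinearMap.ext_ring ?_)
  exact h a

/-- A retraction of Cathelineau's map `D`. -/
lemma exists_retraction_beta2 (k : Type*) [Field k] [CharZero k] :
    ∃ s : TensorProduct ℤ k (Additive kˣ) →ₗ[k] beta2 k,
      ∀ (a : kflat k) (u v : kˣ), (u : k) = (a : k) → (v : k) = 1 - (a : k) →
        s ((a : k) ⊗ₜ Additive.ofMul u + (1 - (a : k)) ⊗ₜ Additive.ofMul v) = beta2Mk a := by
  obtain ⟨g, hadd, hmul⟩ := exists_leibniz_cobounding_beta2Cocycle k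
  have g_one : g 1 = 0 := by simpa using hmul 1 1
  let l : Additive kˣ →+ beta2 k := AddMonoidHom.mk' (fun b => -((b.toMul⁻¹ : kˣ) : k) • g b.toMul)
    fun b c => by
      simp only [toMul_add, Units.val_mul, hmul, Units.val_inv_eq_inv_val, mul_inv]
      match_scalars <;> field_simp
  refine ⟨LinearMap.liftBaseChange k l.toIntLinearMap, fun a u v hu hv => ?_⟩
  have key (b : kˣ) : (b : k) • l (Additive.ofMul b) = -g b := by
    simp [l, smul_smul]
  rw [map_add, LinearMap.liftBaseChange_tmul, LinearMap.liftBaseChange_tmul, ← hu]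
  have hv' : 1 - (u : k) = v := by rw [hv, hu]
  have huv : (u : k) + v = 1 := by rw [hv, hu, add_sub_cancel]
  rw [hv', AddMonoidHom.coe_toIntLinearMap, key, key]
  have := hadd u v
  rw [huv, g_one, beta2Cocycle, huv, div_one, one_smul, hu, beta2Symbol_coe, ← hu] at this
  linear_combination (norm := module) this

/-- Modulo the elements `a ⊗ a + (1 - a) ⊗ (1 - a)`, the map `b ↦ b ⊗ b` is a derivation. -/
lemma exists_hom_kaehlerDifferential_of_range_le (k : Type*) [Field k] [CharZero k]
    (N : Submodule k (TensorProduct ℤ k (Additive kˣ)))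
    (hN : ∀ (a : kflat k) (u v : kˣ), (u : k) = (a : k) → (v : k) = 1 - (a : k) →
      (a : k) ⊗ₜ Additive.ofMul u + (1 - (a : k)) ⊗ₜ Additive.ofMul v ∈ N) :
    ∃ t : Ω[k⁄ℚ] →ₗ[k] TensorProduct ℤ k (Additive kˣ) ⧸ N,
      ∀ b : kˣ, t (KaehlerDifferential.D ℚ k (b : k)) = N.mkQ ((b : k) ⊗ₜ Additive.ofMul b) := by
  classical
  let δ : k → TensorProduct ℤ k (Additive kˣ) := fun a =>
    if h : a = 0 then 0 else a ⊗ₜ Additive.ofMul (Units.mk0 a h)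
  have δ_zero : δ 0 = 0 := dif_pos rfl
  have δ_unit (b : kˣ) : δ b = (b : k) ⊗ₜ Additive.ofMul b := by
    simp only [δ, dif_neg b.ne_zero, Units.mk0_val]
  have δ_mul (a b : k) : δ (a * b) = a • δ b + b • δ a := by
    by_cases ha : a = 0
    · simp [ha, δ_zero]
    by_cases hb : b = 0
    · simp [hb, δ_zero]
    lift a to kˣ using IsUnit.mk0 a ha
    lift b to kˣ using IsUnit.mk0 b hb
    rw [← Units.val_mul, δ_unit, δ_unit, δ_unit, TensorProduct.smul_tmul',
      TensorProduct.smul_tmul', ofMul_mul, TensorProduct.tmul_add, smul_eq_mul, smul_eq_mul,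
      Units.val_mul, mul_comm (b : k), add_comm]
  have δ_one : δ 1 = 0 := by simpa using δ_mul 1 1
  have δ_neg_one : δ (-1) = 0 := by
    have h := δ_mul (-1) (-1)
    rw [neg_one_mul, neg_neg, δ_one, ← add_smul] at h
    exact (smul_eq_zero.1 h.symm).resolve_left (by norm_num)
  have δ_neg (a : k) : δ (-a) = -δ a := by
    rw [← neg_one_mul, δ_mul, δ_neg_one, smul_zero, add_zero, neg_one_smul]
  have δ_one_sub (x : k) : δ x + δ (1 - x) ∈ N := by
    by_cases h0 : x = 0
    · simp [h0, δ_zero, δ_one]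
    by_cases h1 : 1 - x = 0
    · obtain rfl := sub_eq_zero.1 h1
      simp [δ_zero, δ_one]
    have := hN ⟨x, IsUnit.mk0 x h0, IsUnit.mk0 _ h1⟩ (Units.mk0 x h0) (Units.mk0 _ h1) rfl rfl
    simpa only [δ, dif_neg h0, dif_neg h1] using this
  have δ_add (a b : k) : N.mkQ (δ (a + b)) = N.mkQ (δ a) + N.mkQ (δ b) := by
    by_cases h : a + b = 0
    · obtain rfl := eq_neg_of_add_eq_zero_right h
      rw [h, δ_zero, δ_neg, map_neg, map_zero, add_neg_cancel]
    have ha : a = (a + b) * (a / (a + b)) := by field_simp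
    have hb : b = (a + b) * (1 - a / (a + b)) := by field_simp; ring
    rw [← map_add, ← sub_eq_zero, ← map_sub, Submodule.mkQ_apply, Submodule.Quotient.mk_eq_zero]
    have h1 := N.smul_mem (a + b) (δ_one_sub (a / (a + b)))
    have h2 : δ a = _ := (congrArg δ ha).trans (δ_mul _ _)
    have h3 : δ b = _ := (congrArg δ hb).trans (δ_mul _ _)
    have : δ (a + b) - (δ a + δ b) =
        -((a + b) • (δ (a / (a + b)) + δ (1 - a / (a + b)))) := by
      rw [h2, h3]; module
    rw [this]
    exact N.neg_mem h1
  let d : Derivation ℚ k (TensorProduct ℤ k (Additive kˣ) ⧸ N) :=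
    Derivation.mk' (AddMonoidHom.toRatLinearMap (AddMonoidHom.mk' (fun a => N.mkQ (δ a)) δ_add))
      fun a b => by
        change N.mkQ (δ (a * b)) = a • N.mkQ (δ b) + b • N.mkQ (δ a)
        rw [δ_mul, map_add, map_smul, map_smul]
  refine ⟨d.liftKaehlerDifferential, fun b => ?_⟩
  rw [Derivation.liftKaehlerDifferential_comp_D, ← δ_unit]
  rfl

/-- Cathelineau's theorem: the sequence `0 → β₂(k) → k ⊗_ℤ k^× → Ω¹_{k/ℚ} → 0` is exact,
where `D` is the `k`-linear map induced by `D⟨a⟩ = a ⊗ a + (1-a) ⊗ (1-a)` and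
`L` sends `a ⊗ b` to `a · db/b`. -/
theorem cathelineau_exact_sequence (k : Type*) [Field k] [CharZero k]
    (D : beta2 k →ₗ[k] TensorProduct ℤ k (Additive kˣ))
    (hD : ∀ (a : kflat k) (u v : kˣ), (u : k) = (a : k) → (v : k) = 1 - (a : k) →
      D (beta2Mk a) =
        (a : k) ⊗ₜ Additive.ofMul u + (1 - (a : k)) ⊗ₜ Additive.ofMul v)
    (L : TensorProduct ℤ k (Additive kˣ) →ₗ[k] Ω[k⁄ℚ])
    (hL : ∀ (a : k) (b : kˣ),
      L (a ⊗ₜ Additive.ofMul b) =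
        a • (((b⁻¹ : kˣ) : k) • KaehlerDifferential.D ℚ k (b : k))) :
    Function.Injective D ∧ Function.Surjective L ∧ LinearMap.range D = LinearMap.ker L := by
  refine ⟨?_, ?_, le_antisymm ?_ ?_⟩
  · obtain ⟨s, hs⟩ := exists_retraction_beta2 k
    have h : s ∘ₗ D = LinearMap.id := by
      refine beta2_hom_ext fun a => ?_
      simp only [LinearMap.comp_apply, LinearMap.id_apply]
      rw [hD a a.2.1.unit a.2.2.unit rfl rfl, hs a _ _ rfl rfl]
    exact Function.LeftInverse.injective (g := s) fun x => LinearMap.congr_fun h x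
  · rw [← LinearMap.range_eq_top, eq_top_iff, ← KaehlerDifferential.span_range_derivation,
      Submodule.span_le]
    rintro _ ⟨a, rfl⟩
    by_cases ha : a = 0
    · simp [ha]
    · refine ⟨a ⊗ₜ Additive.ofMul (Units.mk0 a ha), ?_⟩
      rw [hL, smul_smul]
      simp [ha]
  · rw [LinearMap.range_le_ker_iff]
    refine beta2_hom_ext fun a => ?_
    rw [LinearMap.comp_apply, hD a a.2.1.unit a.2.2.unit rfl rfl, map_add, hL, hL, smul_smul,
      smul_smul]
    have h0 : (a : k) ≠ 0 := a.2.1.ne_zero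
    have h1 : 1 - (a : k) ≠ 0 := a.2.2.ne_zero
    simp [h0, h1]
  · obtain ⟨t, ht⟩ := exists_hom_kaehlerDifferential_of_range_le k (LinearMap.range D)
      fun a u v hu hv => ⟨beta2Mk a, hD a u v hu hv⟩
    intro x hx
    have h : t ∘ₗ L = (LinearMap.range D).mkQ := by
      refine TensorProduct.AlgebraTensorModule.ext fun a b => ?_
      obtain ⟨b, rfl⟩ := Additive.ofMul.surjective b
      rw [LinearMap.comp_apply, hL, map_smul, map_smul, ht b, ← map_smul, ← map_smul,
        TensorProduct.smul_tmul', TensorProduct.smul_tmul', smul_eq_mul, smul_eq_mul,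
        Units.inv_mul, mul_one]
    rw [← Submodule.ker_mkQ (LinearMap.range D), LinearMap.mem_ker, ← h, LinearMap.comp_apply,
      LinearMap.mem_ker.1 hx, map_zero]
end

section
/- Let F be a field of characteristic p, with p a prime, and define Kontsevich's 1½-logarithm £₁: F → F by £₁(s) := Σ_{k=1}^{p-1} s^k / k. Then for every x ∈ F with x ≠ 0, one has £₁(x) = -x^p · £₁(1/x). -/
/-- Kontsevich's 1½-logarithm `£₁(s) = Σ_{k=1}^{p-1} s^k/k`. -/
noncomputable def kontsevichLog (F : Type*) [Field F] (p : ℕ) (s : F) : F :=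
  ∑ k ∈ Finset.Icc 1 (p - 1), s ^ k / (k : F)

/-- `£₁(x) = -x^p · £₁(1/x)` for `x ≠ 0`. -/
theorem kontsevichLog_inv (F : Type*) [Field F] (p : ℕ) (hp : p.Prime) [CharP F p] :
    ∀ x : F, x ≠ 0 → kontsevichLog F p x = -(x ^ p * kontsevichLog F p x⁻¹) := by
  intro x hx
  unfold kontsevichLog
  rw [Finset.mul_sum, ← Finset.sum_neg_distrib]
  refine Finset.sum_nbij' (fun k => p - k) (fun k => p - k) ?_ ?_ ?_ ?_ ?_
  iterate 4
    · intro k hk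
      simp only [Finset.mem_Icc] at hk ⊢
      omega
  · intro k hk
    have hkp : k ≤ p := by
      have := Finset.mem_Icc.mp hk
      omega
    have hpow : x ^ p * x⁻¹ ^ (p - k) = x ^ k := by
      rw [inv_pow, ← div_eq_mul_inv, div_eq_iff (pow_ne_zero _ hx), ← pow_add,
        Nat.add_sub_cancel' hkp]
    rw [Nat.cast_sub hkp, CharP.cast_eq_zero F p, zero_sub, div_neg, mul_neg, neg_neg,
      ← mul_div_assoc, hpow]
end
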